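/- Suppose (r̄₁, r̄₂, r̄₃) ∈ ℝ³_{>0} generates a degenerate triangle. Then the extended signed angle θ_{ij,k} is continuous at (r̄₁, r̄₂, r̄₃) from the admissible region: if the flat vertex is v₃, then as admissible triples (r₁, r₂, r₃) tend to (r̄₁, r̄₂, r̄₃) one has arctan(h_{12,3}/d₁₂) → −π/2, arctan(h_{13,2}/d₁₃) → π/2 and arctan(h_{23,1}/d₂₃) → π/2; equivalently, each θ_{ij,k} extends to a continuous function on the closure of the admissible space. -/

import Mathlib

/-- Inversive distance edge length for radii `a, b` and weight `I` on the edge. -/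
noncomputable def lenr (I a b : ℝ) : ℝ :=
  Real.sqrt (a ^ 2 + b ^ 2 + 2 * a * b * I)

/-- Length `l₁₂` of the triple `p = (r₁, r₂, r₃)` (weight `I₃` on the edge `v₁v₂`). -/
noncomputable def l12 (I₃ : ℝ) (p : ℝ × ℝ × ℝ) : ℝ := lenr I₃ p.1 p.2.1

/-- Length `l₁₃` of the triple `p = (r₁, r₂, r₃)` (weight `I₂` on the edge `v₁v₃`). -/
noncomputable def l13 (I₂ : ℝ) (p : ℝ × ℝ × ℝ) : ℝ := lenr I₂ p.1 p.2.2

/-- Length `l₂₃` of the triple `p = (r₁, r₂, r₃)` (weight `I₁` on the edge `v₂v₃`). -/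
noncomputable def l23 (I₁ : ℝ) (p : ℝ × ℝ × ℝ) : ℝ := lenr I₁ p.2.1 p.2.2

/-- The admissible space: positive triples whose induced lengths satisfy the
strict triangle inequalities. -/
def admSet (I₁ I₂ I₃ : ℝ) : Set (ℝ × ℝ × ℝ) :=
  {p | 0 < p.1 ∧ 0 < p.2.1 ∧ 0 < p.2.2 ∧
    l12 I₃ p < l13 I₂ p + l23 I₁ p ∧
    l13 I₂ p < l12 I₃ p + l23 I₁ p ∧
    l23 I₁ p < l12 I₃ p + l13 I₂ p}

/-- Inner angle `θ₁` at the vertex `v₁`. -/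
noncomputable def theta1' (I₁ I₂ I₃ : ℝ) (p : ℝ × ℝ × ℝ) : ℝ :=
  Real.arccos ((l12 I₃ p ^ 2 + l13 I₂ p ^ 2 - l23 I₁ p ^ 2) / (2 * l12 I₃ p * l13 I₂ p))

/-- `A = l₁₂ l₁₃ sin θ₁`. -/
noncomputable def areaA (I₁ I₂ I₃ : ℝ) (p : ℝ × ℝ × ℝ) : ℝ :=
  l12 I₃ p * l13 I₂ p * Real.sin (theta1' I₁ I₂ I₃ p)

/-- `h₃ = κ₃(1 − I₃²) + κ₁γ₂ + κ₂γ₁`. -/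
noncomputable def hfun3 (I₁ I₂ I₃ : ℝ) (p : ℝ × ℝ × ℝ) : ℝ :=
  (1 / p.2.2) * (1 - I₃ ^ 2) + (1 / p.1) * (I₂ + I₁ * I₃) + (1 / p.2.1) * (I₁ + I₂ * I₃)

/-- `h₂ = κ₂(1 − I₂²) + κ₁γ₃ + κ₃γ₁`. -/
noncomputable def hfun2 (I₁ I₂ I₃ : ℝ) (p : ℝ × ℝ × ℝ) : ℝ :=
  (1 / p.2.1) * (1 - I₂ ^ 2) + (1 / p.1) * (I₃ + I₁ * I₂) + (1 / p.2.2) * (I₁ + I₂ * I₃)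

/-- `h₁ = κ₁(1 − I₁²) + κ₂γ₃ + κ₃γ₂`. -/
noncomputable def hfun1 (I₁ I₂ I₃ : ℝ) (p : ℝ × ℝ × ℝ) : ℝ :=
  (1 / p.1) * (1 - I₁ ^ 2) + (1 / p.2.1) * (I₃ + I₁ * I₂) + (1 / p.2.2) * (I₂ + I₁ * I₃)

/-- `h₁₂,₃ = r₁²r₂²r₃² κ₃ h₃ / (A l₁₂)`. -/
noncomputable def H123 (I₁ I₂ I₃ : ℝ) (p : ℝ × ℝ × ℝ) : ℝ :=
  p.1 ^ 2 * p.2.1 ^ 2 * p.2.2 ^ 2 * ((1 / p.2.2) * hfun3 I₁ I₂ I₃ p) /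
    (areaA I₁ I₂ I₃ p * l12 I₃ p)

/-- `h₁₃,₂ = r₁²r₂²r₃² κ₂ h₂ / (A l₁₃)`. -/
noncomputable def H132 (I₁ I₂ I₃ : ℝ) (p : ℝ × ℝ × ℝ) : ℝ :=
  p.1 ^ 2 * p.2.1 ^ 2 * p.2.2 ^ 2 * ((1 / p.2.1) * hfun2 I₁ I₂ I₃ p) /
    (areaA I₁ I₂ I₃ p * l13 I₂ p)

/-- `h₂₃,₁ = r₁²r₂²r₃² κ₁ h₁ / (A l₂₃)`. -/
noncomputable def H231 (I₁ I₂ I₃ : ℝ) (p : ℝ × ℝ × ℝ) : ℝ :=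
  p.1 ^ 2 * p.2.1 ^ 2 * p.2.2 ^ 2 * ((1 / p.1) * hfun1 I₁ I₂ I₃ p) /
    (areaA I₁ I₂ I₃ p * l23 I₁ p)


/-- `d₁₂ = (r₁² + r₁r₂I₃)/l₁₂`. -/
noncomputable def d12 (I₃ : ℝ) (p : ℝ × ℝ × ℝ) : ℝ :=
  (p.1 ^ 2 + p.1 * p.2.1 * I₃) / l12 I₃ p

/-- `d₁₃ = (r₁² + r₁r₃I₂)/l₁₃`. -/
noncomputable def d13 (I₂ : ℝ) (p : ℝ × ℝ × ℝ) : ℝ :=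
  (p.1 ^ 2 + p.1 * p.2.2 * I₂) / l13 I₂ p

/-- `d₂₃ = (r₂² + r₂r₃I₁)/l₂₃`. -/
noncomputable def d23 (I₁ : ℝ) (p : ℝ × ℝ × ℝ) : ℝ :=
  (p.2.1 ^ 2 + p.2.1 * p.2.2 * I₁) / l23 I₁ p

open Filter Topology

/-- The squared edge length is the radicand. -/
theorem lenr_sq {I a b : ℝ} (hI : 1 < I) (ha : 0 < a) (hb : 0 < b) :
    lenr I a b ^ 2 = a ^ 2 + b ^ 2 + 2 * a * b * I := by
  unfold lenr
  exact Real.sq_sqrt (by positivity)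

theorem lenr_pos {I a b : ℝ} (hI : 1 < I) (ha : 0 < a) (hb : 0 < b) : 0 < lenr I a b := by
  unfold lenr
  exact Real.sqrt_pos.2 (by positivity)

theorem add_lt_lenr {I a b : ℝ} (hI : 1 < I) (ha : 0 < a) (hb : 0 < b) : a + b < lenr I a b := by
  refine lt_of_pow_lt_pow_left₀ 2 (lenr_pos hI ha hb).le ?_
  rw [lenr_sq hI ha hb]
  nlinarith [mul_pos (mul_pos ha hb) (sub_pos.2 hI)]

theorem continuous_lenr {X : Type*} [TopologicalSpace X] {f g : X → ℝ} (I : ℝ)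
    (hf : Continuous f) (hg : Continuous g) : Continuous fun x => lenr I (f x) (g x) := by
  unfold lenr
  fun_prop

/-- Three disjoint circles centred on a line, the third one between the other two at distances
`a` and `b`: the quantity comparing the positions of the radical axes has a definite sign. -/
theorem stewart_lt {a b r₁ r₂ r₃ : ℝ} (h₁ : 0 < r₁) (h₂ : 0 < r₂) (h₃ : 0 < r₃)
    (ha : r₁ + r₃ < a) (hb : r₂ + r₃ < b) :
    b * r₁ ^ 2 + a * r₂ ^ 2 < (a + b) * (r₃ ^ 2 + a * b) := by
  have ha0 : 0 < a := by linarith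
  have hb0 : 0 < b := by linarith
  have e₁ : r₁ ^ 2 ≤ (a - r₃) ^ 2 := pow_le_pow_left₀ h₁.le (by linarith) 2
  have e₂ : r₂ ^ 2 ≤ (b - r₃) ^ 2 := pow_le_pow_left₀ h₂.le (by linarith) 2
  nlinarith [mul_le_mul_of_nonneg_left e₁ hb0.le, mul_le_mul_of_nonneg_left e₂ ha0.le,
    mul_pos (mul_pos ha0 hb0) h₃]

/-- At a triangle with flat vertex `v₃`, `h₃` is negative while `h₁` and `h₂` are positive. -/
theorem hfun_signs_of_flat {I₁ I₂ I₃ r₁ r₂ r₃ : ℝ}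
    (hI₁ : 1 < I₁) (hI₂ : 1 < I₂) (hI₃ : 1 < I₃) (h₁ : 0 < r₁) (h₂ : 0 < r₂) (h₃ : 0 < r₃)
    (hdeg : lenr I₃ r₁ r₂ = lenr I₂ r₁ r₃ + lenr I₁ r₂ r₃) :
    hfun3 I₁ I₂ I₃ (r₁, r₂, r₃) < 0 ∧ 0 < hfun2 I₁ I₂ I₃ (r₁, r₂, r₃) ∧
      0 < hfun1 I₁ I₂ I₃ (r₁, r₂, r₃) := by
  have hc := lenr_sq hI₃ h₁ h₂
  have ha := lenr_sq hI₂ h₁ h₃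
  have hb := lenr_sq hI₁ h₂ h₃
  have hlt := stewart_lt h₁ h₂ h₃ (add_lt_lenr hI₂ h₁ h₃) (add_lt_lenr hI₁ h₂ h₃)
  have ha0 := lenr_pos hI₂ h₁ h₃
  have hb0 := lenr_pos hI₁ h₂ h₃
  rw [hdeg] at hc
  generalize lenr I₂ r₁ r₃ = a at *
  generalize lenr I₁ r₂ r₃ = b at *
  obtain rfl : I₃ = ((a + b) ^ 2 - r₁ ^ 2 - r₂ ^ 2) / (2 * r₁ * r₂) := by
    field_simp; linarith
  obtain rfl : I₂ = (a ^ 2 - r₁ ^ 2 - r₃ ^ 2) / (2 * r₁ * r₃) := by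
    field_simp; linarith
  obtain rfl : I₁ = (b ^ 2 - r₂ ^ 2 - r₃ ^ 2) / (2 * r₂ * r₃) := by
    field_simp; linarith
  have hk : 0 < (a + b) * (r₃ ^ 2 + a * b) - (b * r₁ ^ 2 + a * r₂ ^ 2) := sub_pos.2 hlt
  refine ⟨?_, ?_, ?_⟩
  · have e : hfun3 ((b ^ 2 - r₂ ^ 2 - r₃ ^ 2) / (2 * r₂ * r₃))
        ((a ^ 2 - r₁ ^ 2 - r₃ ^ 2) / (2 * r₁ * r₃))
        (((a + b) ^ 2 - r₁ ^ 2 - r₂ ^ 2) / (2 * r₁ * r₂)) (r₁, r₂, r₃) =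
        -((a + b) * ((a + b) * (r₃ ^ 2 + a * b) - (b * r₁ ^ 2 + a * r₂ ^ 2)) /
          (2 * r₁ ^ 2 * r₂ ^ 2 * r₃)) := by
      unfold hfun3; field_simp; ring
    rw [e, neg_lt_zero]; positivity
  · have e : hfun2 ((b ^ 2 - r₂ ^ 2 - r₃ ^ 2) / (2 * r₂ * r₃))
        ((a ^ 2 - r₁ ^ 2 - r₃ ^ 2) / (2 * r₁ * r₃))
        (((a + b) ^ 2 - r₁ ^ 2 - r₂ ^ 2) / (2 * r₁ * r₂)) (r₁, r₂, r₃) =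
        a * ((a + b) * (r₃ ^ 2 + a * b) - (b * r₁ ^ 2 + a * r₂ ^ 2)) /
          (2 * r₁ ^ 2 * r₂ * r₃ ^ 2) := by
      unfold hfun2; field_simp; ring
    rw [e]; positivity
  · have e : hfun1 ((b ^ 2 - r₂ ^ 2 - r₃ ^ 2) / (2 * r₂ * r₃))
        ((a ^ 2 - r₁ ^ 2 - r₃ ^ 2) / (2 * r₁ * r₃))
        (((a + b) ^ 2 - r₁ ^ 2 - r₂ ^ 2) / (2 * r₁ * r₂)) (r₁, r₂, r₃) =
        b * ((a + b) * (r₃ ^ 2 + a * b) - (b * r₁ ^ 2 + a * r₂ ^ 2)) /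
          (2 * r₁ * r₂ ^ 2 * r₃ ^ 2) := by
      unfold hfun1; field_simp; ring
    rw [e]; positivity

theorem continuous_l12 (I : ℝ) : Continuous (l12 I) := continuous_lenr I (by fun_prop) (by fun_prop)

theorem continuous_l13 (I : ℝ) : Continuous (l13 I) := continuous_lenr I (by fun_prop) (by fun_prop)

theorem continuous_l23 (I : ℝ) : Continuous (l23 I) := continuous_lenr I (by fun_prop) (by fun_prop)

/-- The area function is positive on the admissible space. -/
theorem areaA_pos {I₁ I₂ I₃ : ℝ} (hI₂ : 1 < I₂) (hI₃ : 1 < I₃)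
    {p : ℝ × ℝ × ℝ} (hp : p ∈ admSet I₁ I₂ I₃) : 0 < areaA I₁ I₂ I₃ p := by
  obtain ⟨h₁, h₂, h₃, t₁, t₂, t₃⟩ := hp
  have hc : 0 < l12 I₃ p := lenr_pos hI₃ h₁ h₂
  have ha : 0 < l13 I₂ p := lenr_pos hI₂ h₁ h₃
  have hb : 0 ≤ l23 I₁ p := Real.sqrt_nonneg _
  unfold areaA theta1'
  refine mul_pos (mul_pos hc ha) ?_
  rw [Real.sin_arccos, Real.sqrt_pos, sub_pos, sq_lt_one_iff_abs_lt_one, abs_lt]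
  constructor
  · rw [lt_div_iff₀ (by positivity)]
    nlinarith
  · rw [div_lt_one (by positivity)]
    nlinarith

/-- The reciprocal area blows up at a triangle with flat vertex `v₃`. -/
theorem tendsto_inv_areaA_atTop {I₁ I₂ I₃ : ℝ} (hI₂ : 1 < I₂) (hI₃ : 1 < I₃)
    {q : ℝ × ℝ × ℝ} (h₁ : 0 < q.1) (h₂ : 0 < q.2.1) (h₃ : 0 < q.2.2)
    (hdeg : l12 I₃ q = l13 I₂ q + l23 I₁ q) :
    Tendsto (fun p => (areaA I₁ I₂ I₃ p)⁻¹) (𝓝[admSet I₁ I₂ I₃] q) atTop := by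
  have hc : 0 < l12 I₃ q := lenr_pos hI₃ h₁ h₂
  have ha : 0 < l13 I₂ q := lenr_pos hI₂ h₁ h₃
  have hcont : ContinuousAt (areaA I₁ I₂ I₃) q := by
    have cc := (continuous_l12 I₃).continuousAt (x := q)
    have ca := (continuous_l13 I₂).continuousAt (x := q)
    have cb := (continuous_l23 I₁).continuousAt (x := q)
    refine (cc.mul ca).mul (Real.continuous_sin.continuousAt.comp
      (Real.continuous_arccos.continuousAt.comp ?_))
    exact (((cc.pow 2).add (ca.pow 2)).sub (cb.pow 2)).div ((cc.const_mul 2).mul ca) (by positivity)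
  have hzero : areaA I₁ I₂ I₃ q = 0 := by
    have e : (l12 I₃ q ^ 2 + l13 I₂ q ^ 2 - l23 I₁ q ^ 2) / (2 * l12 I₃ q * l13 I₂ q) = 1 := by
      rw [div_eq_one_iff_eq (by positivity), show l23 I₁ q = l12 I₃ q - l13 I₂ q by linarith]
      ring
    simp [areaA, theta1', e]
  refine Tendsto.inv_tendsto_nhdsGT_zero (tendsto_nhdsWithin_iff.2 ⟨?_, ?_⟩)
  · simpa [hzero] using hcont.tendsto.mono_left nhdsWithin_le_nhds
  · filter_upwards [self_mem_nhdsWithin] with p hp using areaA_pos hI₂ hI₃ hp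

theorem tendsto_arctan_mul_of_pos {X : Type*} {l : Filter X} {f g : X → ℝ} {c : ℝ} (hc : 0 < c)
    (hf : Tendsto f l (𝓝 c)) (hg : Tendsto g l atTop) :
    Tendsto (fun x => Real.arctan (f x * g x)) l (𝓝 (Real.pi / 2)) :=
  (Real.tendsto_arctan_atTop.mono_right nhdsWithin_le_nhds).comp (hf.pos_mul_atTop hc hg)

theorem tendsto_arctan_mul_of_neg {X : Type*} {l : Filter X} {f g : X → ℝ} {c : ℝ} (hc : c < 0)
    (hf : Tendsto f l (𝓝 c)) (hg : Tendsto g l atTop) :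
    Tendsto (fun x => Real.arctan (f x * g x)) l (𝓝 (-(Real.pi / 2))) :=
  (Real.tendsto_arctan_atBot.mono_right nhdsWithin_le_nhds).comp (hf.neg_mul_atTop hc hg)

/-- Lemma 2.9: the extended signed angles `θ_{ij,k}` are continuous at a
degenerate triple from the admissible region: if the flat vertex is `v₃`, then
as admissible triples tend to `(r̄₁, r̄₂, r̄₃)` one has
`arctan(h₁₂,₃/d₁₂) → −π/2`, `arctan(h₁₃,₂/d₁₃) → π/2`, `arctan(h₂₃,₁/d₂₃) → π/2`,
i.e. each `θ_{ij,k}` extends continuously to the closure of the admissible space. -/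
theorem stmt_13 (I₁ I₂ I₃ rb₁ rb₂ rb₃ : ℝ)
    (hI₁ : 1 < I₁) (hI₂ : 1 < I₂) (hI₃ : 1 < I₃)
    (hr₁ : 0 < rb₁) (hr₂ : 0 < rb₂) (hr₃ : 0 < rb₃)
    (hdeg : l12 I₃ (rb₁, rb₂, rb₃) = l13 I₂ (rb₁, rb₂, rb₃) + l23 I₁ (rb₁, rb₂, rb₃)) :
    Filter.Tendsto (fun p => Real.arctan (H123 I₁ I₂ I₃ p / d12 I₃ p))
      (nhdsWithin ((rb₁, rb₂, rb₃) : ℝ × ℝ × ℝ) (admSet I₁ I₂ I₃))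
      (nhds (-(Real.pi / 2))) ∧
    Filter.Tendsto (fun p => Real.arctan (H132 I₁ I₂ I₃ p / d13 I₂ p))
      (nhdsWithin ((rb₁, rb₂, rb₃) : ℝ × ℝ × ℝ) (admSet I₁ I₂ I₃))
      (nhds (Real.pi / 2)) ∧
    Filter.Tendsto (fun p => Real.arctan (H231 I₁ I₂ I₃ p / d23 I₁ p))
      (nhdsWithin ((rb₁, rb₂, rb₃) : ℝ × ℝ × ℝ) (admSet I₁ I₂ I₃))
      (nhds (Real.pi / 2)) := by
  obtain ⟨s₃, s₂, s₁⟩ := hfun_signs_of_flat hI₁ hI₂ hI₃ hr₁ hr₂ hr₃ hdeg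
  have hA := tendsto_inv_areaA_atTop (q := (rb₁, rb₂, rb₃)) hI₂ hI₃ hr₁ hr₂ hr₃ hdeg
  have pc : 0 < l12 I₃ (rb₁, rb₂, rb₃) := lenr_pos hI₃ hr₁ hr₂
  have pa : 0 < l13 I₂ (rb₁, rb₂, rb₃) := lenr_pos hI₂ hr₁ hr₃
  have pb : 0 < l23 I₁ (rb₁, rb₂, rb₃) := lenr_pos hI₁ hr₂ hr₃
  have cc := (continuous_l12 I₃).continuousAt (x := (rb₁, rb₂, rb₃))
  have ca := (continuous_l13 I₂).continuousAt (x := (rb₁, rb₂, rb₃))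
  have cb := (continuous_l23 I₁).continuousAt (x := (rb₁, rb₂, rb₃))
  have pd₁₂ : 0 < d12 I₃ (rb₁, rb₂, rb₃) := div_pos (by dsimp only; positivity) pc
  have pd₁₃ : 0 < d13 I₂ (rb₁, rb₂, rb₃) := div_pos (by dsimp only; positivity) pa
  have pd₂₃ : 0 < d23 I₁ (rb₁, rb₂, rb₃) := div_pos (by dsimp only; positivity) pb
  have cd₁₂ : ContinuousAt (d12 I₃) (rb₁, rb₂, rb₃) :=
    ContinuousAt.div (by fun_prop) cc pc.ne'
  have cd₁₃ : ContinuousAt (d13 I₂) (rb₁, rb₂, rb₃) :=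
    ContinuousAt.div (by fun_prop) ca pa.ne'
  have cd₂₃ : ContinuousAt (d23 I₁) (rb₁, rb₂, rb₃) :=
    ContinuousAt.div (by fun_prop) cb pb.ne'
  have k₁ : ContinuousAt (fun p : ℝ × ℝ × ℝ => 1 / p.1) (rb₁, rb₂, rb₃) :=
    ContinuousAt.div (by fun_prop) (by fun_prop) hr₁.ne'
  have k₂ : ContinuousAt (fun p : ℝ × ℝ × ℝ => 1 / p.2.1) (rb₁, rb₂, rb₃) :=
    ContinuousAt.div (by fun_prop) (by fun_prop) hr₂.ne'
  have k₃ : ContinuousAt (fun p : ℝ × ℝ × ℝ => 1 / p.2.2) (rb₁, rb₂, rb₃) :=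
    ContinuousAt.div (by fun_prop) (by fun_prop) hr₃.ne'
  have ch₁ : ContinuousAt (hfun1 I₁ I₂ I₃) (rb₁, rb₂, rb₃) :=
    ((k₁.mul_const _).add (k₂.mul_const _)).add (k₃.mul_const _)
  have ch₂ : ContinuousAt (hfun2 I₁ I₂ I₃) (rb₁, rb₂, rb₃) :=
    ((k₂.mul_const _).add (k₁.mul_const _)).add (k₃.mul_const _)
  have ch₃ : ContinuousAt (hfun3 I₁ I₂ I₃) (rb₁, rb₂, rb₃) :=
    ((k₃.mul_const _).add (k₁.mul_const _)).add (k₂.mul_const _)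
  have cr : ContinuousAt (fun p : ℝ × ℝ × ℝ => p.1 ^ 2 * p.2.1 ^ 2 * p.2.2 ^ 2)
      (rb₁, rb₂, rb₃) := by fun_prop
  have c₃ := (cr.mul (k₃.mul ch₃)).div (cc.mul cd₁₂) (mul_pos pc pd₁₂).ne'
  have c₂ := (cr.mul (k₂.mul ch₂)).div (ca.mul cd₁₃) (mul_pos pa pd₁₃).ne'
  have c₁ := (cr.mul (k₁.mul ch₁)).div (cb.mul cd₂₃) (mul_pos pb pd₂₃).ne'
  refine ⟨?_, ?_, ?_⟩
  · refine (tendsto_arctan_mul_of_neg ?_ (c₃.tendsto.mono_left nhdsWithin_le_nhds) hA).congr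
      fun p => ?_
    · exact div_neg_of_neg_of_pos (mul_neg_of_pos_of_neg (by dsimp only; positivity)
        (mul_neg_of_pos_of_neg (one_div_pos.2 hr₃) s₃)) (mul_pos pc pd₁₂)
    · congr 1; simp only [H123, Pi.mul_apply, Pi.div_apply, div_eq_mul_inv, mul_inv]; ring
  · refine (tendsto_arctan_mul_of_pos ?_ (c₂.tendsto.mono_left nhdsWithin_le_nhds) hA).congr
      fun p => ?_
    · exact div_pos (mul_pos (by dsimp only; positivity)
        (mul_pos (one_div_pos.2 hr₂) s₂)) (mul_pos pa pd₁₃)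
    · congr 1; simp only [H132, Pi.mul_apply, Pi.div_apply, div_eq_mul_inv, mul_inv]; ring
  · refine (tendsto_arctan_mul_of_pos ?_ (c₁.tendsto.mono_left nhdsWithin_le_nhds) hA).congr
      fun p => ?_
    · exact div_pos (mul_pos (by dsimp only; positivity)
        (mul_pos (one_div_pos.2 hr₁) s₁)) (mul_pos pb pd₂₃)
    · congr 1; simp only [H231, Pi.mul_apply, Pi.div_apply, div_eq_mul_inv, mul_inv]; ring
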